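/- R(K_{2,8}, K_{2,10}) = 33. That is: every simple graph on 33 vertices contains a subgraph isomorphic to the complete bipartite graph K_{2,8} or its complement contains a subgraph isomorphic to K_{2,10}, and there exists a simple graph on 32 vertices containing no subgraph isomorphic to K_{2,8} whose complement contains no subgraph isomorphic to K_{2,10}. -/

import Mathlib

/-- `H` is contained in `G` as a (not necessarily induced) subgraph. -/
def containsCopy {α β : Type*} (H : SimpleGraph α) (G : SimpleGraph β) : Prop :=
  ∃ f : α ↪ β, ∀ ⦃a b : α⦄, H.Adj a b → G.Adj (f a) (f b)

/-- The number of common neighbours of two vertices. -/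
def codegree {V : Type*} [Fintype V] (G : SimpleGraph V) [DecidableRel G.Adj] (u v : V) : ℕ :=
  (Finset.univ.filter fun w => G.Adj u w ∧ G.Adj v w).card

/-- A graph contains `K_{2,n}` iff two distinct vertices have at least `n` common neighbours. -/
theorem containsCopy_completeBipartiteGraph_two_iff {V : Type*} [Fintype V]
    (G : SimpleGraph V) [DecidableRel G.Adj] (n : ℕ) :
    containsCopy (completeBipartiteGraph (Fin 2) (Fin n)) G ↔
      ∃ u v, u ≠ v ∧ n ≤ codegree G u v := by
  constructor
  · rintro ⟨f, hf⟩
    refine ⟨f (Sum.inl 0), f (Sum.inl 1), fun h => by simpa using f.injective h, ?_⟩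
    have hcard : (Finset.univ.map (Function.Embedding.inr.trans f) : Finset V).card = n := by
      simp
    refine hcard.symm.trans_le (Finset.card_le_card fun w hw => ?_)
    obtain ⟨i, -, rfl⟩ := Finset.mem_map.mp hw
    simp only [Finset.mem_filter, Finset.mem_univ, true_and]
    exact ⟨hf (by simp), hf (by simp)⟩
  · rintro ⟨u, v, huv, hn⟩
    obtain ⟨t, hts, htn⟩ := Finset.exists_subset_card_eq hn
    have ht : ∀ w ∈ t, G.Adj u w ∧ G.Adj v w := fun w hw => by simpa using hts hw
    let e := (t.equivFinOfCardEq htn).symm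
    have he : ∀ i : Fin n, G.Adj u (e i) ∧ G.Adj v (e i) := fun i => ht _ (e i).2
    let g : Fin 2 ⊕ Fin n → V := Sum.elim ![u, v] fun i => e i
    have hg : Function.Injective g := by
      refine Function.Injective.sumElim ?_ (Subtype.val_injective.comp e.injective) ?_
      · intro i j hij
        fin_cases i <;> fin_cases j <;> simp_all
      · intro i j
        fin_cases i
        · exact (he j).1.ne
        · exact (he j).2.ne
    have hadj : ∀ (i : Fin 2) (j : Fin n), G.Adj (g (Sum.inl i)) (g (Sum.inr j)) := by
      intro i j
      fin_cases i
      · exact (he j).1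
      · exact (he j).2
    refine ⟨⟨g, hg⟩, ?_⟩
    rintro (i | i) (j | j) hij
    · simp at hij
    · exact hadj i j
    · exact (hadj j i).symm
    · simp at hij

section Counting

variable {V : Type*} (G : SimpleGraph V) [DecidableRel G.Adj]

/-- The adjacency indicator, with integer values. -/
def adjInd (u v : V) : ℤ := if G.Adj u v then 1 else 0

theorem adjInd_comm (u v : V) : adjInd G u v = adjInd G v u := by
  simp [adjInd, G.adj_comm]

variable [Fintype V]

/-- The deviation of the degree of a vertex from `15`. -/
def degDev (v : V) : ℤ := (G.degree v : ℤ) - 15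

theorem sum_adjInd (v : V) : ∑ u, adjInd G v u = 15 + degDev G v := by
  simp only [adjInd, degDev, Finset.sum_boole]
  rw [← G.card_neighborFinset_eq_degree, G.neighborFinset_eq_filter]
  ring

theorem codegree_eq_sum (u v : V) :
    (codegree G u v : ℤ) = ∑ w, adjInd G u w * adjInd G v w := by
  rw [codegree, ← Finset.sum_boole]
  refine Finset.sum_congr rfl fun w _ => ?_
  by_cases h1 : G.Adj u w <;> by_cases h2 : G.Adj v w <;> simp [adjInd, h1, h2]

theorem sum_codegree (v : V) :
    ∑ u, (codegree G v u : ℤ) = ∑ w, adjInd G v w * (15 + degDev G w) := by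
  simp only [codegree_eq_sum]
  rw [Finset.sum_comm]
  refine Finset.sum_congr rfl fun w _ => ?_
  rw [← Finset.mul_sum, ← sum_adjInd]
  simp only [adjInd_comm G w]

theorem codegree_self (v : V) : (codegree G v v : ℤ) = 15 + degDev G v := by
  rw [codegree_eq_sum, ← sum_adjInd]
  refine Finset.sum_congr rfl fun w _ => ?_
  unfold adjInd
  split_ifs <;> simp

variable [DecidableEq V]

theorem codegree_compl {u v : V} (huv : u ≠ v) :
    (codegree Gᶜ u v : ℤ) = Fintype.card V - 30 - degDev G u - degDev G v + codegree G u v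
      - 2 * (1 - adjInd G u v) := by
  have key : ∀ w, adjInd Gᶜ u w * adjInd Gᶜ v w =
      1 - adjInd G u w - adjInd G v w + adjInd G u w * adjInd G v w
        - (if w = u then 1 - adjInd G u v else 0) - (if w = v then 1 - adjInd G u v else 0) := by
    intro w
    by_cases h1 : w = u
    · subst h1
      simp [adjInd, huv, G.adj_comm v w]
    · by_cases h2 : w = v
      · subst h2
        simp [adjInd, h1]
      · by_cases h3 : G.Adj u w <;> by_cases h4 : G.Adj v w <;>
          simp [adjInd, h1, h2, h3, h4, Ne.symm h1, Ne.symm h2]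
  rw [codegree_eq_sum, Finset.sum_congr rfl fun w _ => key w]
  simp only [Finset.sum_sub_distrib, Finset.sum_add_distrib, sum_adjInd, ← codegree_eq_sum,
    Finset.sum_ite_eq', Finset.mem_univ, if_true]
  simp
  ring

/-- The slack in the codegree bounds around a vertex is controlled by its degree deviation. -/
theorem sum_slack_le (hV : Fintype.card V = 33) (v : V) (E : V → ℤ) (hv : E v = 0)
    (hE : ∀ u, u ≠ v → (codegree G v u : ℤ) ≤
      7 - adjInd G v u * (1 - degDev G v - degDev G u) - E u) :
    ∑ u, E u ≤ degDev G v ^ 2 - 1 := by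
  have h : ∑ u, (codegree G v u : ℤ) ≤ ∑ u, (7 - adjInd G v u * (1 - degDev G v)
      + adjInd G v u * degDev G u - E u + if u = v then 8 + degDev G v else 0) := by
    refine Finset.sum_le_sum fun u _ => ?_
    by_cases huv : u = v
    · subst huv
      rw [codegree_self, hv]
      simp [adjInd]
      linarith
    · have := hE u huv
      rw [if_neg huv]
      linarith
  rw [sum_codegree] at h
  simp only [mul_add, Finset.sum_sub_distrib, Finset.sum_add_distrib, ← Finset.sum_mul,
    sum_adjInd, Finset.sum_ite_eq', Finset.mem_univ, if_true, Finset.sum_const, Finset.card_univ,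
    hV] at h
  simp only [nsmul_eq_mul] at h
  push_cast at h
  nlinarith

variable {G}

/-- On `33` vertices some pair of vertices has at least `8` common neighbours or at least `10`
common non-neighbours. -/
theorem exists_le_codegree (hV : Fintype.card V = 33) :
    ∃ u v, u ≠ v ∧ (8 ≤ codegree G u v ∨ 10 ≤ codegree Gᶜ u v) := by
  by_contra! hcon
  have hc7 : ∀ u v, u ≠ v → (codegree G u v : ℤ) ≤ 7 := fun u v h =>
    mod_cast Nat.le_of_lt_succ (hcon u v h).1
  have hc9 : ∀ u v, u ≠ v → (codegree G u v : ℤ) ≤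
      6 + degDev G u + degDev G v + 2 * (1 - adjInd G u v) := by
    intro u v h
    have h1 := codegree_compl G h
    have h2 : (codegree Gᶜ u v : ℤ) ≤ 9 := mod_cast Nat.le_of_lt_succ (hcon u v h).2
    rw [hV] at h1
    push_cast at h1
    linarith
  have hne : ∀ v, degDev G v ≠ 0 := by
    intro v hv
    have := sum_slack_le G hV v (fun _ => 0) rfl fun u hu => by
      have h1 := hc7 v u hu.symm
      have h2 := hc9 v u hu.symm
      unfold adjInd at h2 ⊢
      split_ifs at h2 ⊢ <;> linarith
    simp [hv] at this
  let P : V → ℤ := fun u => if 0 < degDev G u then 1 else 0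
  have hPpos : ∀ v, 0 < degDev G v → ∑ u, P u ≤ 17 := by
    intro v hv
    have h := sum_slack_le G hV v (fun u => degDev G v * (adjInd G v u * P u))
      (by simp [adjInd]) fun u hu => by
        have h1 := hc7 v u hu.symm
        have h2 := hc9 v u hu.symm
        simp only [adjInd, P] at h2 ⊢
        split_ifs at h2 ⊢ <;> linarith
    rw [← Finset.mul_sum] at h
    have h1 : ∑ u, adjInd G v u * P u ≤ degDev G v - 1 := by
      by_contra! hlt
      nlinarith
    have h2 : ∑ u, adjInd G v u ≤ ∑ u, (adjInd G v u * P u + (1 - P u)) := by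
      refine Finset.sum_le_sum fun u _ => ?_
      simp only [adjInd, P]
      split_ifs <;> norm_num
    rw [Finset.sum_add_distrib, Finset.sum_sub_distrib, sum_adjInd] at h2
    simp only [Finset.sum_const, Finset.card_univ, hV, nsmul_eq_mul] at h2
    push_cast at h2
    linarith
  have hPneg : ∀ v, degDev G v < 0 → 18 ≤ ∑ u, P u := by
    intro v hv
    have h := sum_slack_le G hV v
      (fun u => -degDev G v * (if u = v then 0 else (1 - adjInd G v u) * (1 - P u)))
      (by simp) fun u hu => by
        have h1 := hc7 v u hu.symm
        have h2 := hc9 v u hu.symm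
        have h3 := hne u
        simp only [adjInd, P, if_neg hu] at h2 ⊢
        split_ifs at h2 ⊢ <;> omega
    rw [← Finset.mul_sum] at h
    have h1 : ∑ u, (if u = v then 0 else (1 - adjInd G v u) * (1 - P u)) ≤ -degDev G v - 1 := by
      by_contra! hlt
      nlinarith
    have h2 : ∑ u, (1 - adjInd G v u) ≤ ∑ u, ((if u = v then 0 else
        (1 - adjInd G v u) * (1 - P u)) + P u + if u = v then 1 else 0) := by
      refine Finset.sum_le_sum fun u _ => ?_
      simp only [adjInd, P]
      split_ifs <;> norm_num
    rw [Finset.sum_add_distrib, Finset.sum_add_distrib, Finset.sum_sub_distrib, sum_adjInd] at h2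
    simp only [Finset.sum_const, Finset.card_univ, hV, nsmul_eq_mul, Finset.sum_ite_eq',
      Finset.mem_univ, if_true] at h2
    push_cast at h2
    linarith
  by_cases hpos : ∃ v, 0 < degDev G v
  · obtain ⟨v, hv⟩ := hpos
    have h17 := hPpos v hv
    by_cases hneg : ∃ v, degDev G v < 0
    · obtain ⟨w, hw⟩ := hneg
      linarith [hPneg w hw]
    · push Not at hneg
      have hP : ∀ u, P u = 1 := fun u => if_pos (lt_of_le_of_ne (hneg u) (hne u).symm)
      simp [hP, hV] at h17
  · push Not at hpos
    have hP : ∀ u, P u = 0 := fun u => if_neg (hpos u).not_gt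
    obtain ⟨v⟩ : Nonempty V := Fintype.card_pos_iff.mp (by omega)
    have := hPneg v (lt_of_le_of_ne (hpos v) (hne v))
    simp [hP] at this

end Counting

/-- Adjacency rows, as bit masks, of a graph on `32` vertices with an automorphism of order `7`
whose pairs of vertices have at most `7` common neighbours and `9` common non-neighbours. -/
def ramseyRows : List ℕ :=
  [2811335960, 2936236592, 2921764064, 2892835137, 2834961027, 2717148422, 2747845260,
    1817244500, 1755440809, 1633914322, 1657215781, 1703818826, 1797008533, 1714969002,
    2593759714, 2503164869, 2588329739, 2494402070, 2572885036, 2461431896, 2504847537,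
    1393206076, 1444218616, 1544179057, 1479842403, 1349088327, 1355982991, 1367691678,
    1342160896, 2147500031, 534790016, 538951807]

/-- The graph on `32` vertices given by `ramseyRows`. -/
def ramseyGraph : SimpleGraph (Fin 32) where
  Adj i j := (ramseyRows.getD i 0).testBit j = true
  symm := ⟨by decide +kernel⟩
  loopless := ⟨by decide +kernel⟩

instance : DecidableRel ramseyGraph.Adj := fun i j =>
  inferInstanceAs (Decidable ((ramseyRows.getD i 0).testBit j = true))

theorem codegree_ramseyGraph_le :
    ∀ u v, u ≠ v → codegree ramseyGraph u v ≤ 7 := by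
  decide +kernel

theorem codegree_compl_ramseyGraph_le :
    ∀ u v, u ≠ v → codegree ramseyGraphᶜ u v ≤ 9 := by
  decide +kernel

/-- R(K₂,₈, K₂,₁₀) = 33. -/
theorem ramsey_K28_K210_eq_33 :
    (∀ G : SimpleGraph (Fin 33),
      containsCopy (completeBipartiteGraph (Fin 2) (Fin 8)) G ∨
      containsCopy (completeBipartiteGraph (Fin 2) (Fin 10)) Gᶜ) ∧
    (∃ G : SimpleGraph (Fin 32),
      ¬ containsCopy (completeBipartiteGraph (Fin 2) (Fin 8)) G ∧
      ¬ containsCopy (completeBipartiteGraph (Fin 2) (Fin 10)) Gᶜ) := by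
  constructor
  · intro G
    classical
    obtain ⟨u, v, huv, h | h⟩ := exists_le_codegree (G := G) (Fintype.card_fin 33)
    · exact .inl ((containsCopy_completeBipartiteGraph_two_iff G 8).mpr ⟨u, v, huv, h⟩)
    · exact .inr ((containsCopy_completeBipartiteGraph_two_iff Gᶜ 10).mpr ⟨u, v, huv, h⟩)
  · refine ⟨ramseyGraph, ?_, ?_⟩
    · rw [containsCopy_completeBipartiteGraph_two_iff]
      rintro ⟨u, v, huv, h⟩
      exact absurd (h.trans (codegree_ramseyGraph_le u v huv)) (by norm_num)
    · rw [containsCopy_completeBipartiteGraph_two_iff]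
      rintro ⟨u, v, huv, h⟩
      exact absurd (h.trans (codegree_compl_ramseyGraph_le u v huv)) (by norm_num)
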